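/- arXiv:1011.2997 — 2 statements merged into one kernel-verified Lean document; each statement's English description precedes it below -/
import Mathlib

section
/- For every integer i ≥ 1: the centralizer of ∂^i in I₁ equals K[∂]; the centralizer of ∫^i in I₁ equals K[∫]; and the centralizer of x^i in I₁ equals K[x] (the subalgebra of multiplication operators by polynomials). -/
open Polynomial

noncomputable section
set_option synthInstance.maxHeartbeats 1000000
set_option maxHeartbeats 1000000
set_option linter.unusedSectionVars false

variable (K : Type*) [Field K] [CharZero K]

/-- The derivative operator `∂ = d/dx` on `K[x]`. -/
def derOp : Module.End K (Polynomial K) := Polynomial.derivative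

/-- The multiplication-by-`x` operator on `K[x]`. -/
def xOp : Module.End K (Polynomial K) := LinearMap.mulLeft K Polynomial.X

/-- The integration operator `∫`, determined by `∫ xⁿ = xⁿ⁺¹/(n+1)`. -/
def intOp : Module.End K (Polynomial K) :=
  (Polynomial.basisMonomials K).constr K fun n => ((n : K) + 1)⁻¹ • X ^ (n + 1)

/-- The algebra `I₁` of polynomial integro-differential operators: the subalgebra of
`End_K(K[x])` generated by `x`, `∂` and `∫`. -/
def I1 : Subalgebra K (Module.End K (Polynomial K)) :=
  Algebra.adjoin K {xOp K, derOp K, intOp K}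

/-- `e_{ij} := ∫^i ∂^j − ∫^{i+1} ∂^{j+1}`. -/
def eOp (i j : ℕ) : Module.End K (Polynomial K) :=
  intOp K ^ i * derOp K ^ j - intOp K ^ (i + 1) * derOp K ^ (j + 1)

/-- `F`, the `K`-linear span of the `e_{ij}`; it is the (two-sided) ideal of compact
operators of `I₁`. -/
def Fset : Submodule K (Module.End K (Polynomial K)) :=
  Submodule.span K {f | ∃ i j, f = eOp K i j}

lemma xOp_mem : xOp K ∈ I1 K := Algebra.subset_adjoin (by simp)
lemma derOp_mem : derOp K ∈ I1 K := Algebra.subset_adjoin (by simp)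
lemma intOp_mem : intOp K ∈ I1 K := Algebra.subset_adjoin (by simp)

lemma eOp_mem (i j : ℕ) : eOp K i j ∈ I1 K :=
  sub_mem (mul_mem (pow_mem (intOp_mem K) i) (pow_mem (derOp_mem K) j))
    (mul_mem (pow_mem (intOp_mem K) (i + 1)) (pow_mem (derOp_mem K) (j + 1)))

/-- `e_{ij}` as an element of the ring `I₁`. -/
def eI (i j : ℕ) : I1 K := ⟨eOp K i j, eOp_mem K i j⟩

/-- `∂` as an element of the ring `I₁`. -/
def derI : I1 K := ⟨derOp K, derOp_mem K⟩

/-- `∫` as an element of the ring `I₁`. -/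
def intI : I1 K := ⟨intOp K, intOp_mem K⟩

/-- `H := ∂ ∘ x` (first multiply by `x`, then differentiate). -/
def hOp : Module.End K (Polynomial K) := derOp K * xOp K

/-- `K[H]`, the unital subalgebra of `I₁` generated by `H`. -/
def KH : Subalgebra K (Module.End K (Polynomial K)) := Algebra.adjoin K {hOp K}

/-- The action of `a ∈ I₁` on a left `I₁`-module `M`, as a `K`-linear map `a_M : M → M`. -/
def actMap (a : I1 K) (M : Type*) [AddCommGroup M] [Module (I1 K) M] [Module K M]
    [SMulCommClass K (I1 K) M] : M →ₗ[K] M where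
  toFun m := a • m
  map_add' := smul_add a
  map_smul' k m := (smul_comm k a m).symm

/-- Right multiplication `b ↦ b * a` in a ring `R`, as a homomorphism of left `R`-modules. -/
def rmulMap (R : Type*) [Ring R] (a : R) : R →ₗ[R] R where
  toFun b := b * a
  map_add' b c := add_mul b c a
  map_smul' c b := by simp [smul_eq_mul, mul_assoc]

/-- Left multiplication `b ↦ a * b` in a ring `R`, as a homomorphism of right `R`-modules
(i.e. of left `Rᵐᵒᵖ`-modules). -/
def lmulMap (R : Type*) [Ring R] (a : R) : R →ₗ[Rᵐᵒᵖ] R where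
  toFun b := a * b
  map_add' b c := mul_add a b c
  map_smul' c b := by simp [MulOpposite.smul_eq_mul_unop, mul_assoc]

/-- The centralizer `Cen_{I₁}(a) = {b ∈ I₁ : ab = ba}` of `a` in `I₁`, as a subalgebra of
`End_K(K[x])`. -/
def Cen (a : Module.End K (Polynomial K)) : Subalgebra K (Module.End K (Polynomial K)) :=
  I1 K ⊓ Subalgebra.centralizer K {a}

/-- `Cen_F(a) = {f ∈ F : af = fa}`, a `K`-subspace of `End_K(K[x])`. -/
def CenF (a : Module.End K (Polynomial K)) : Submodule K (Module.End K (Polynomial K)) :=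
  Fset K ⊓ Subalgebra.toSubmodule (Subalgebra.centralizer K {a})


section Centralizers

/-- A sequence that eventually agrees with a rational function of the index. -/
def EventuallyRational (f : ℕ → K) : Prop :=
  ∃ p q : K[X], q ≠ 0 ∧ ∀ᶠ n : ℕ in Filter.atTop, q.eval (n : K) * f n = p.eval (n : K)

namespace EventuallyRational

variable {K}
variable {f f' : ℕ → K}

lemma of_polynomial (p : K[X]) : EventuallyRational K fun n => p.eval (n : K) :=
  ⟨p, 1, one_ne_zero, by simp⟩

lemma const (c : K) : EventuallyRational K fun _ => c := by
  simpa using of_polynomial (C c)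

lemma add (hf : EventuallyRational K f) (hf' : EventuallyRational K f') :
    EventuallyRational K fun n => f n + f' n := by
  obtain ⟨p, q, hq, h⟩ := hf
  obtain ⟨p', q', hq', h'⟩ := hf'
  refine ⟨p * q' + p' * q, q * q', mul_ne_zero hq hq', ?_⟩
  filter_upwards [h, h'] with n hn hn'
  simp only [eval_mul, eval_add, ← hn, ← hn']
  ring

lemma mul (hf : EventuallyRational K f) (hf' : EventuallyRational K f') :
    EventuallyRational K fun n => f n * f' n := by
  obtain ⟨p, q, hq, h⟩ := hf
  obtain ⟨p', q', hq', h'⟩ := hf'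
  refine ⟨p * p', q * q', mul_ne_zero hq hq', ?_⟩
  filter_upwards [h, h'] with n hn hn'
  simp only [eval_mul, ← hn, ← hn']
  ring

lemma sum {ι : Type*} (s : Finset ι) {F : ι → ℕ → K}
    (h : ∀ u ∈ s, EventuallyRational K (F u)) :
    EventuallyRational K fun n => ∑ u ∈ s, F u n := by
  classical
  induction s using Finset.induction_on with
  | empty => simpa using const (0 : K)
  | insert a s ha ih =>
    simp only [Finset.sum_insert ha]
    exact (h a (by simp)).add (ih fun u hu => h u (by simp [hu]))

lemma of_shift (d : ℕ) (hf : EventuallyRational K fun n => f (n + d)) :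
    EventuallyRational K f := by
  obtain ⟨p, q, hq, h⟩ := hf
  refine ⟨taylor (-(d : K)) p, taylor (-(d : K)) q, ?_, ?_⟩
  · exact fun h0 => hq (taylor_injective (-(d : K)) (by simpa using h0))
  · obtain ⟨N, hN⟩ := Filter.eventually_atTop.1 h
    refine Filter.eventually_atTop.2 ⟨N + d, fun n hn => ?_⟩
    obtain ⟨m, rfl⟩ := Nat.exists_eq_add_of_le' (show d ≤ n by omega)
    simpa [taylor_eval] using hN m (by omega)

/-- In characteristic zero, a periodic rational sequence is constant. -/
lemma eq_of_periodic (hf : EventuallyRational K f) {i : ℕ} (hi : 1 ≤ i)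
    (hper : ∀ n, f (n + i) = f n) (m n : ℕ) : f m = f n := by
  obtain ⟨p, q, hq, h⟩ := hf
  obtain ⟨N, hN⟩ := Filter.eventually_atTop.1 h
  have key : ∀ n₀, C (f n₀) * q = p := by
    intro n₀
    have hk : ∀ k, f (n₀ + i * k) = f n₀ := by
      intro k
      induction k with
      | zero => simp
      | succ k ih => rw [mul_add, mul_one, ← add_assoc, hper, ih]
    refine eq_of_infinite_eval_eq _ _ ?_
    refine Set.Infinite.mono ?_ (Set.infinite_range_of_injective
      (f := fun k : ℕ => ((n₀ + i * (k + N) : ℕ) : K)) ?_)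
    · rintro _ ⟨k, rfl⟩
      have hle : N ≤ n₀ + i * (k + N) := by nlinarith
      have := hN _ hle
      rw [hk] at this
      simpa [mul_comm] using this
    · intro a b hab
      have h1 : n₀ + i * (a + N) = n₀ + i * (b + N) := Nat.cast_injective hab
      have h2 := Nat.eq_of_mul_eq_mul_left (by omega) (Nat.add_left_cancel h1)
      omega
  have := (key m).trans (key n).symm
  exact C_injective (mul_right_cancel₀ hq this)

lemma inv_add_succ (s : ℕ) : EventuallyRational K fun n => ((n : K) + (s + 1))⁻¹ := by
  refine ⟨1, X + C ((s : K) + 1), X_add_C_ne_zero _, .of_forall fun n => ?_⟩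
  have : (n : K) + (s + 1) ≠ 0 := by exact_mod_cast (by omega : n + (s + 1) ≠ 0)
  simp [this]

lemma inv_factorial_ratio (s t : ℕ) :
    EventuallyRational K fun n => ((n + s).factorial : K)⁻¹ / ((n + t).factorial : K)⁻¹ := by
  have hne : ∀ n : ℕ, (n.factorial : K) ≠ 0 := fun n => by exact_mod_cast n.factorial_ne_zero
  have hnum : EventuallyRational K fun n => ((n + t).factorial : K) / (n.factorial : K) := by
    induction t with
    | zero => simpa [hne] using const (1 : K)
    | succ t ih =>
      convert ih.mul (of_polynomial (X + C ((t : K) + 1))) using 2 with n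
      rw [← add_assoc, Nat.factorial_succ]
      simp
      ring
  have hden : EventuallyRational K fun n => (n.factorial : K) / ((n + s).factorial : K) := by
    induction s with
    | zero => simpa [hne] using const (1 : K)
    | succ s ih =>
      convert ih.mul (inv_add_succ s) using 2 with n
      rw [← add_assoc, Nat.factorial_succ, div_mul_eq_mul_div, div_eq_div_iff
        (mod_cast Nat.mul_ne_zero (Nat.succ_ne_zero _) (Nat.factorial_ne_zero _)) (hne _)]
      have : (n : K) + (s + 1) ≠ 0 := by exact_mod_cast (by omega : n + (s + 1) ≠ 0)
      field_simp
      push_cast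
      ring
  convert hnum.mul hden using 2 with n
  field_simp [hne]

end EventuallyRational

/-- An operator whose matrix in the monomial basis is banded with eventually rational
diagonals. -/
def BandedRational (b : Module.End K K[X]) : Prop :=
  (∃ d : ℕ, ∀ n m : ℕ, (b (X ^ n)).coeff m ≠ 0 → n ≤ m + d ∧ m ≤ n + d) ∧
  ∀ s t : ℕ, EventuallyRational K fun n => (b (X ^ (n + s))).coeff (n + t)

namespace BandedRational

variable {K}
variable {b b' : Module.End K K[X]}

lemma add (h : BandedRational K b) (h' : BandedRational K b') : BandedRational K (b + b') := by
  obtain ⟨⟨d, hd⟩, hr⟩ := h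
  obtain ⟨⟨d', hd'⟩, hr'⟩ := h'
  refine ⟨⟨d + d', fun n m hnm => ?_⟩, fun s t => ?_⟩
  · by_cases h0 : (b (X ^ n)).coeff m = 0
    · have := hd' n m (by simpa [h0] using hnm)
      omega
    · have := hd n m h0
      omega
  · simpa using (hr s t).add (hr' s t)

lemma mul (h : BandedRational K b) (h' : BandedRational K b') : BandedRational K (b * b') := by
  obtain ⟨⟨d, hd⟩, hr⟩ := h
  obtain ⟨⟨d', hd'⟩, hr'⟩ := h'
  refine ⟨⟨d + d', fun n m hnm => ?_⟩, fun s t => ?_⟩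
  · rw [Module.End.mul_apply, (b' (X ^ n)).as_sum_support_C_mul_X_pow, map_sum,
      finsetSum_coeff] at hnm
    obtain ⟨k, hk, hne⟩ := Finset.exists_ne_zero_of_sum_ne_zero hnm
    rw [← smul_eq_C_mul, map_smul, coeff_smul] at hne
    have h1 := hd k m (right_ne_zero_of_smul hne)
    have h2 := hd' n k (mem_support_iff.1 hk)
    omega
  · refine EventuallyRational.of_shift d' ?_
    convert EventuallyRational.sum (Finset.range (s + d' + d' + 1)) fun u _ =>
      (hr' (s + d') u).mul (hr u (t + d')) using 2 with n
    have hexp : b' (X ^ (n + (s + d'))) = ∑ u ∈ Finset.range (s + d' + d' + 1),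
        (b' (X ^ (n + (s + d')))).coeff (n + u) • X ^ (n + u) := by
      ext m
      simp only [finsetSum_coeff, coeff_smul, coeff_X_pow, smul_eq_mul, mul_ite, mul_one,
        mul_zero]
      by_cases h0 : (b' (X ^ (n + (s + d')))).coeff m = 0
      · rw [h0, Finset.sum_eq_zero]
        intro u _
        split_ifs with hu
        · rw [← hu, h0]
        · rfl
      · have h1 := hd' _ _ h0
        rw [Finset.sum_eq_single (m - n)]
        · rw [if_pos (by omega), Nat.add_sub_cancel' (by omega)]
        · intro u _ hu
          rw [if_neg (by omega)]
        · intro hu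
          simp only [Finset.mem_range] at hu
          omega
    rw [Module.End.mul_apply, add_right_comm, add_assoc n s d', add_right_comm n d' t,
      add_assoc n t d']
    have := congrArg (fun p => (b p).coeff (n + (t + d'))) hexp
    simpa only [map_sum, map_smul, finsetSum_coeff, coeff_smul, smul_eq_mul] using this

lemma algebraMap (c : K) : BandedRational K (algebraMap K (Module.End K K[X]) c) := by
  refine ⟨⟨0, fun n m h => ?_⟩, fun s t => ?_⟩
  · simp [Module.algebraMap_end_apply, coeff_X_pow] at h
    omega
  · simpa [Module.algebraMap_end_apply, coeff_X_pow] using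
      EventuallyRational.const (if t = s then c else 0)

end BandedRational

variable {K}

lemma xOp_apply (p : K[X]) : xOp K p = X * p := rfl

lemma derOp_apply (p : K[X]) : derOp K p = derivative p := rfl

lemma intOp_X_pow (n : ℕ) : intOp K (X ^ n) = ((n : K) + 1)⁻¹ • X ^ (n + 1) := by
  have := (basisMonomials K).constr_basis K
    (fun n : ℕ => ((n : K) + 1)⁻¹ • (X : K[X]) ^ (n + 1)) n
  simp only [coe_basisMonomials, ← X_pow_eq_monomial] at this
  exact this

lemma bandedRational_xOp : BandedRational K (xOp K) := by
  refine ⟨⟨1, fun n m h => ?_⟩, fun s t => ?_⟩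
  · rw [xOp_apply, ← pow_succ', coeff_X_pow] at h
    have : m = n + 1 := by by_contra h0; simp [h0] at h
    omega
  · convert EventuallyRational.const (if t = s + 1 then (1 : K) else 0) using 2 with n
    rw [xOp_apply, ← pow_succ', coeff_X_pow]
    exact if_congr (by omega) rfl rfl

lemma bandedRational_derOp : BandedRational K (derOp K) := by
  refine ⟨⟨1, fun n m h => ?_⟩, fun s t => ?_⟩
  · rw [derOp_apply, coeff_derivative, coeff_X_pow] at h
    have : m + 1 = n := by by_contra h0; simp [h0] at h
    omega
  · convert (EventuallyRational.const (if t + 1 = s then (1 : K) else 0)).mul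
      (EventuallyRational.of_polynomial (X + C ((t : K) + 1))) using 2 with n
    rw [derOp_apply, coeff_derivative, coeff_X_pow]
    congr 1
    · exact if_congr (by omega) rfl rfl
    · simp [add_assoc]

lemma bandedRational_intOp : BandedRational K (intOp K) := by
  refine ⟨⟨1, fun n m h => ?_⟩, fun s t => ?_⟩
  · rw [intOp_X_pow, coeff_smul, coeff_X_pow] at h
    have : m = n + 1 := by by_contra h0; simp [h0] at h
    omega
  · convert (EventuallyRational.inv_add_succ s).mul
      (EventuallyRational.const (if t = s + 1 then (1 : K) else 0)) using 2 with n
    rw [intOp_X_pow, coeff_smul, coeff_X_pow, smul_eq_mul]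
    congr 1
    · simp [add_assoc]
    · exact if_congr (by omega) rfl rfl

lemma bandedRational_of_mem_I1 {b : Module.End K K[X]} (hb : b ∈ I1 K) :
    BandedRational K b := by
  induction hb using Algebra.adjoin_induction with
  | mem a ha =>
    rcases ha with rfl | rfl | rfl
    exacts [bandedRational_xOp, bandedRational_derOp, bandedRational_intOp]
  | algebraMap c => exact .algebraMap c
  | add _ _ _ _ h h' => exact h.add h'
  | mul _ _ _ _ h h' => exact h.mul h'

lemma end_ext_monomial {g : ℕ → K} (hg : ∀ n, g n ≠ 0) {b b' : Module.End K K[X]}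
    (h : ∀ n, b (monomial n (g n)) = b' (monomial n (g n))) : b = b' := by
  refine lhom_ext' fun n => LinearMap.ext_ring ?_
  have := congrArg (fun p => (g n)⁻¹ • p) (h n)
  simpa [← map_smul, smul_monomial, hg n] using this

lemma ext_scaled_coeff {g : ℕ → K} (hg : ∀ n, g n ≠ 0) {p p' : K[X]}
    (h : ∀ m, p.coeff m / g m = p'.coeff m / g m) : p = p' :=
  Polynomial.ext fun m => (div_left_inj' (hg m)).1 (h m)

/-- If the diagonals of a banded rational operator are periodic in a rescaled monomial basis,
then they are constant. -/
lemma BandedRational.coeff_succ_of_periodic {g : ℕ → K}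
    (hgr : ∀ s t : ℕ, EventuallyRational K fun n => g (n + s) / g (n + t))
    {b : Module.End K K[X]} (hb : BandedRational K b) {i : ℕ} (hi : 1 ≤ i)
    (hper : ∀ m n, (b (monomial (n + i) (g (n + i)))).coeff (m + i) / g (m + i)
      = (b (monomial n (g n))).coeff m / g m) (m n : ℕ) :
    (b (monomial (n + 1) (g (n + 1)))).coeff (m + 1) / g (m + 1)
      = (b (monomial n (g n))).coeff m / g m := by
  have hr : EventuallyRational K fun k =>
      (b (monomial (k + n) (g (k + n)))).coeff (k + m) / g (k + m) := by
    convert (hb.2 n m).mul (hgr n m) using 2 with k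
    rw [← mul_one (g (k + n)), ← smul_eq_mul (g (k + n)) 1, ← smul_monomial,
      ← X_pow_eq_monomial, map_smul, coeff_smul]
    simp only [smul_eq_mul, mul_one]
    ring
  have := hr.eq_of_periodic hi (fun k => by
    have := hper (k + m) (k + n)
    rwa [add_right_comm k m, add_right_comm k n] at this) 1 0
  simpa only [add_comm 1, zero_add] using this

lemma adjoin_le_centralizer_pow {a : Module.End K K[X]} (ha : a ∈ I1 K) (i : ℕ) :
    Algebra.adjoin K {a} ≤ I1 K ⊓ Subalgebra.centralizer K {a ^ i} := by
  refine Algebra.adjoin_le ?_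
  rintro _ rfl
  refine ⟨ha, (Subalgebra.mem_centralizer_iff K).2 ?_⟩
  rintro _ rfl
  exact (Commute.refl _).pow_left i

section Raising

variable {g : ℕ → K} {a : Module.End K K[X]}

lemma raising_pow (hY : ∀ n, a (monomial n (g n)) = monomial (n + 1) (g (n + 1))) (k n : ℕ) :
    (a ^ k) (monomial n (g n)) = monomial (n + k) (g (n + k)) := by
  induction k with
  | zero => simp
  | succ k ih => rw [pow_succ', Module.End.mul_apply, ih, hY, add_assoc]

lemma raising_commute (hg : ∀ n, g n ≠ 0)
    (hgr : ∀ s t : ℕ, EventuallyRational K fun n => g (n + s) / g (n + t))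
    (hY : ∀ n, a (monomial n (g n)) = monomial (n + 1) (g (n + 1)))
    (h0 : ∀ p, (a p).coeff 0 = 0)
    (hc : ∀ p m, (a p).coeff (m + 1) / g (m + 1) = p.coeff m / g m)
    {b : Module.End K K[X]} (hb : BandedRational K b) {i : ℕ} (hi : 1 ≤ i)
    (hcomm : Commute (a ^ i) b) : Commute a b := by
  have hck : ∀ k p m, ((a ^ k) p).coeff (m + k) / g (m + k) = p.coeff m / g m := by
    intro k
    induction k with
    | zero => simp
    | succ k ih =>
      intro p m
      rw [pow_succ', Module.End.mul_apply, ← add_assoc, hc, ih]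
  have hshift : ∀ n, b (monomial (n + i) (g (n + i))) = (a ^ i) (b (monomial n (g n))) := by
    intro n
    rw [← raising_pow hY]
    exact (LinearMap.congr_fun hcomm.eq _).symm
  have hM := hb.coeff_succ_of_periodic hgr hi fun m n => by rw [hshift, hck]
  have hdiag : ∀ k m n, (b (monomial (n + k) (g (n + k)))).coeff (m + k) / g (m + k)
      = (b (monomial n (g n))).coeff m / g m := by
    intro k
    induction k with
    | zero => simp
    | succ k ih => intro m n; rw [← add_assoc, ← add_assoc, hM, ih]
  refine end_ext_monomial hg fun n => ext_scaled_coeff hg fun m => ?_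
  rw [Module.End.mul_apply, Module.End.mul_apply, hY]
  cases m with
  | succ m => rw [hc, hM]
  | zero =>
    obtain ⟨j, rfl⟩ := Nat.exists_eq_add_of_le' hi
    rw [h0, ← hdiag j 0 (n + 1), add_right_comm, add_assoc, hshift, pow_succ,
      Module.End.mul_apply, hck, h0]

lemma raising_mem_adjoin (hg : ∀ n, g n ≠ 0)
    (hY : ∀ n, a (monomial n (g n)) = monomial (n + 1) (g (n + 1)))
    {b : Module.End K K[X]} (hcomm : Commute a b) : b ∈ Algebra.adjoin K {a} := by
  set p := b (monomial 0 (g 0)) with hp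
  have hb : b = ∑ k ∈ p.support, (p.coeff k / g k) • a ^ k := by
    refine end_ext_monomial hg fun n => ?_
    have h1 : b (monomial n (g n)) = (a ^ n) p := by
      have := raising_pow hY n 0
      rw [zero_add] at this
      rw [hp, ← this]
      exact (LinearMap.congr_fun (hcomm.pow_left n).eq _).symm
    rw [h1]
    conv_lhs => rw [p.as_sum_support]
    rw [map_sum, LinearMap.sum_apply]
    refine Finset.sum_congr rfl fun k _ => ?_
    rw [LinearMap.smul_apply, raising_pow hY, add_comm n k, ← raising_pow hY n k, ← map_smul,
      smul_monomial, smul_eq_mul, div_mul_cancel₀ _ (hg k)]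
  rw [hb]
  exact Subalgebra.sum_mem _ fun k _ => Subalgebra.smul_mem _
    (pow_mem (Algebra.self_mem_adjoin_singleton K a) k) _

lemma raising_centralizer (hg : ∀ n, g n ≠ 0)
    (hgr : ∀ s t : ℕ, EventuallyRational K fun n => g (n + s) / g (n + t))
    (ha : a ∈ I1 K)
    (hY : ∀ n, a (monomial n (g n)) = monomial (n + 1) (g (n + 1)))
    (h0 : ∀ p, (a p).coeff 0 = 0)
    (hc : ∀ p m, (a p).coeff (m + 1) / g (m + 1) = p.coeff m / g m)
    {i : ℕ} (hi : 1 ≤ i) :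
    I1 K ⊓ Subalgebra.centralizer K {a ^ i} = Algebra.adjoin K {a} := by
  refine le_antisymm ?_ (adjoin_le_centralizer_pow ha i)
  rintro b ⟨hb, hbc⟩
  exact raising_mem_adjoin hg hY (raising_commute hg hgr hY h0 hc
    (bandedRational_of_mem_I1 hb) hi ((Subalgebra.mem_centralizer_iff K).1 hbc _ rfl))

end Raising

lemma lowering_coeff_pow {g : ℕ → K} {a : Module.End K K[X]}
    (hc : ∀ p m, (a p).coeff m / g m = p.coeff (m + 1) / g (m + 1)) (k : ℕ) (p : K[X]) (m : ℕ) :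
    ((a ^ k) p).coeff m / g m = p.coeff (m + k) / g (m + k) := by
  induction k generalizing p m with
  | zero => simp
  | succ k ih => rw [pow_succ, Module.End.mul_apply, ih, hc, add_assoc]

lemma lowering_commute {g : ℕ → K} {a : Module.End K K[X]} (hg : ∀ n, g n ≠ 0)
    (hgr : ∀ s t : ℕ, EventuallyRational K fun n => g (n + s) / g (n + t))
    (hY : ∀ n, a (monomial (n + 1) (g (n + 1))) = monomial n (g n))
    (h0 : a (monomial 0 (g 0)) = 0)
    (hc : ∀ p m, (a p).coeff m / g m = p.coeff (m + 1) / g (m + 1))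
    {b : Module.End K K[X]} (hb : BandedRational K b) {i : ℕ} (hi : 1 ≤ i)
    (hcomm : Commute (a ^ i) b) : Commute a b := by
  have hYk : ∀ k n, (a ^ k) (monomial (n + k) (g (n + k))) = monomial n (g n) := by
    intro k
    induction k with
    | zero => simp
    | succ k ih =>
      intro n
      rw [pow_succ, Module.End.mul_apply, ← add_assoc, hY, ih]
  have hck := lowering_coeff_pow hc
  have hcomm' : ∀ p, (a ^ i) (b p) = b ((a ^ i) p) := LinearMap.congr_fun hcomm.eq
  have hM := hb.coeff_succ_of_periodic hgr hi fun m n => by rw [← hck, hcomm', hYk]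
  have hdiag : ∀ k m n, (b (monomial (n + k) (g (n + k)))).coeff (m + k) / g (m + k)
      = (b (monomial n (g n))).coeff m / g m := by
    intro k
    induction k with
    | zero => simp
    | succ k ih => intro m n; rw [← add_assoc, ← add_assoc, hM, ih]
  refine end_ext_monomial hg fun n => ext_scaled_coeff hg fun m => ?_
  rw [Module.End.mul_apply, Module.End.mul_apply, hc]
  cases n with
  | succ n => rw [hM, hY]
  | zero =>
    obtain ⟨j, rfl⟩ := Nat.exists_eq_add_of_le' hi
    rw [h0, ← hdiag j (m + 1) 0, add_assoc, add_comm 1 j, ← hck, hcomm', pow_succ',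
      Module.End.mul_apply, hYk, h0]

lemma lowering_mem_adjoin {g : ℕ → K} {a : Module.End K K[X]} (hg : ∀ n, g n ≠ 0)
    (hc : ∀ p m, (a p).coeff m / g m = p.coeff (m + 1) / g (m + 1))
    {b : Module.End K K[X]} (hb : BandedRational K b) (hcomm : Commute a b) :
    b ∈ Algebra.adjoin K {a} := by
  obtain ⟨⟨d, hd⟩, -⟩ := hb
  have hck := lowering_coeff_pow hc
  set c : ℕ → K := fun k => (b (monomial k (g k))).coeff 0 / g 0 with hcdef
  have hcz : ∀ k, d < k → c k = 0 := by
    intro k hk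
    have h0 : (b (X ^ k)).coeff 0 = 0 := by
      by_contra hne
      have := hd k 0 hne
      omega
    simp only [hcdef]
    rw [← mul_one (g k), ← smul_eq_mul (g k) 1, ← smul_monomial, ← X_pow_eq_monomial, map_smul,
      coeff_smul, h0, smul_zero, zero_div]
  set q : Module.End K K[X] := ∑ k ∈ Finset.range (d + 1), c k • a ^ k with hq
  have hqa : q ∈ Algebra.adjoin K {a} := Subalgebra.sum_mem _ fun k _ => Subalgebra.smul_mem _
    (pow_mem (Algebra.self_mem_adjoin_singleton K a) k) _
  have hqcomm : Commute a q :=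
    Commute.sum_right _ _ _ fun k _ => ((Commute.refl a).pow_right k).smul_right _
  have hecomm : Commute a (b - q) := hcomm.sub_right hqcomm
  have hY0 : ∀ n, ((b - q) (monomial n (g n))).coeff 0 / g 0 = 0 := by
    intro n
    have hqn : (q (monomial n (g n))).coeff 0 / g 0 = c n := by
      have hterm : ∀ k, ((c k • a ^ k) (monomial n (g n))).coeff 0 / g 0
          = if k = n then c n else 0 := by
        intro k
        rw [LinearMap.smul_apply, coeff_smul, smul_eq_mul, mul_div_assoc, hck, zero_add,
          coeff_monomial]
        by_cases hkn : k = n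
        · subst hkn
          simp [hg]
        · simp [hkn, Ne.symm hkn]
      rw [hq, LinearMap.sum_apply, finsetSum_coeff, Finset.sum_div]
      simp only [hterm, Finset.sum_ite_eq', Finset.mem_range]
      split_ifs with hn
      · rfl
      · exact (hcz n (by omega)).symm
    rw [LinearMap.sub_apply, coeff_sub, sub_div, hqn, sub_self]
  have he0 : ∀ p, ((b - q) p).coeff 0 = 0 := by
    have : lcoeff K 0 ∘ₗ (b - q) = 0 := by
      refine lhom_ext' fun n => LinearMap.ext_ring ?_
      have := (div_eq_zero_iff.1 (hY0 n)).resolve_right (hg 0)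
      rw [← mul_one (g n), ← smul_eq_mul (g n) 1, ← smul_monomial, map_smul, coeff_smul] at this
      exact (smul_eq_zero.1 this).resolve_left (hg n)
    exact LinearMap.congr_fun this
  have he : b - q = 0 := by
    refine LinearMap.ext fun p => ext_scaled_coeff hg fun m => ?_
    have := hck m ((b - q) p) 0
    rw [zero_add] at this
    rw [← this, show (a ^ m) ((b - q) p) = (b - q) ((a ^ m) p) from
      LinearMap.congr_fun (hecomm.pow_left m).eq p, he0]
    simp
  rwa [sub_eq_zero.1 he]

lemma inv_factorial_ne_zero (n : ℕ) : ((n.factorial : K))⁻¹ ≠ 0 :=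
  inv_ne_zero (by exact_mod_cast n.factorial_ne_zero)

lemma derOp_centralizer {i : ℕ} (hi : 1 ≤ i) :
    I1 K ⊓ Subalgebra.centralizer K {derOp K ^ i} = Algebra.adjoin K {derOp K} := by
  refine le_antisymm ?_ (adjoin_le_centralizer_pow (derOp_mem K) i)
  rintro b ⟨hb, hbc⟩
  have hg := inv_factorial_ne_zero (K := K)
  have hb' := bandedRational_of_mem_I1 hb
  have hc : ∀ (p : K[X]) (m : ℕ), (derOp K p).coeff m / ((m.factorial : K))⁻¹
      = p.coeff (m + 1) / (((m + 1).factorial : K))⁻¹ := by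
    intro p m
    rw [derOp_apply, coeff_derivative, Nat.factorial_succ]
    simp only [div_inv_eq_mul]
    push_cast
    ring
  refine lowering_mem_adjoin hg hc hb' (lowering_commute hg
    EventuallyRational.inv_factorial_ratio (fun n => ?_) ?_ hc hb' hi
    ((Subalgebra.mem_centralizer_iff K).1 hbc _ rfl))
  · rw [derOp_apply, derivative_monomial, Nat.add_sub_cancel, Nat.factorial_succ]
    have : (n : K) + 1 ≠ 0 := by exact_mod_cast n.succ_ne_zero
    congr 1
    push_cast
    field_simp
  · simp [derOp_apply]

lemma intOp_centralizer {i : ℕ} (hi : 1 ≤ i) :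
    I1 K ⊓ Subalgebra.centralizer K {intOp K ^ i} = Algebra.adjoin K {intOp K} := by
  have hsum : ∀ p : K[X],
      intOp K p = ∑ k ∈ p.support, (p.coeff k * ((k : K) + 1)⁻¹) • X ^ (k + 1) := by
    intro p
    conv_lhs => rw [p.as_sum_support_C_mul_X_pow]
    simp only [map_sum, ← smul_eq_C_mul, map_smul, intOp_X_pow, smul_smul]
  refine raising_centralizer inv_factorial_ne_zero EventuallyRational.inv_factorial_ratio
    (intOp_mem K) (fun n => ?_) (fun p => ?_) (fun p m => ?_) hi
  · rw [← mul_one ((n.factorial : K))⁻¹, ← smul_eq_mul _ (1 : K), ← smul_monomial,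
      ← X_pow_eq_monomial, map_smul, intOp_X_pow, smul_smul, X_pow_eq_monomial, smul_monomial,
      Nat.factorial_succ]
    congr 1
    push_cast
    simp [mul_comm]
  · simp [hsum, coeff_X_pow]
  · have : (m : K) + 1 ≠ 0 := by exact_mod_cast m.succ_ne_zero
    have hm : (intOp K p).coeff (m + 1) = p.coeff m * ((m : K) + 1)⁻¹ := by
      rw [hsum, finsetSum_coeff, Finset.sum_eq_single m]
      · simp
      · intro k _ hk
        simp [coeff_X_pow, hk.symm]
      · intro hk
        simp [notMem_support_iff.1 hk]
    rw [hm, Nat.factorial_succ]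
    simp only [div_inv_eq_mul]
    push_cast
    field_simp

lemma xOp_centralizer {i : ℕ} (hi : 1 ≤ i) :
    I1 K ⊓ Subalgebra.centralizer K {xOp K ^ i} = Algebra.adjoin K {xOp K} := by
  refine raising_centralizer (g := fun _ => 1) (fun _ => one_ne_zero)
    (fun _ _ => by simpa using EventuallyRational.const (1 : K))
    (xOp_mem K) (fun n => ?_) (fun p => ?_) (fun p m => ?_) hi
  · rw [xOp_apply, X_mul_monomial]
  · simp [xOp_apply]
  · simp [xOp_apply]

end Centralizers

/-- for `i ≥ 1`, the centralizer of `∂^i` in `I₁` is `K[∂]`, the centralizer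
of `∫^i` is `K[∫]`, and the centralizer of `x^i` is `K[x]`. -/
theorem statement12 (i : ℕ) (hi : 1 ≤ i) :
    I1 K ⊓ Subalgebra.centralizer K {derOp K ^ i} = Algebra.adjoin K {derOp K}
    ∧ I1 K ⊓ Subalgebra.centralizer K {intOp K ^ i} = Algebra.adjoin K {intOp K}
    ∧ I1 K ⊓ Subalgebra.centralizer K {xOp K ^ i} = Algebra.adjoin K {xOp K} := by
  exact ⟨derOp_centralizer hi, intOp_centralizer hi, xOp_centralizer hi⟩

end
end

section
/- Let a ∈ I₁ be a non-scalar element (a ∉ K·1). Then the following are equivalent: (1) a ∉ K[H] + F; (2) Cen_{I₁}(a) is a finitely generated K[a]-module; (3) Cen_{I₁}(a) is a left Noetherian ring; (4) Cen_{I₁}(a) is a right Noetherian ring; (5) Cen_{I₁}(a) is a finitely generated K-algebra which is left and right Noetherian. -/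
open Polynomial

noncomputable section
set_option synthInstance.maxHeartbeats 1000000
set_option maxHeartbeats 1000000
set_option linter.unusedSectionVars false

variable (K : Type*) [Field K] [CharZero K]

open Filter
open scoped Nat

section FiniteCentralizer

variable {K}
variable {U : Type*} [AddCommGroup U] [Module K U]

lemma mem_span_of_shift (α : Module.End K U) (u : ℕ → U) (r N : ℕ) (hr : 0 < r)
    (h : ∀ n, N ≤ n → ∃ c : K, c ≠ 0 ∧
      α (u n) - c • u (n + r) ∈ Submodule.span K (u '' Set.Iio (n + r))) (n : ℕ) :
    Module.AEval'.of α (u n) ∈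
      Submodule.span K[X] ((fun j => Module.AEval'.of α (u j)) '' Set.Iio (N + r)) := by
  induction n using Nat.strong_induction_on with
  | _ n ih =>
    set W := Submodule.span K[X] ((fun j => Module.AEval'.of α (u j)) '' Set.Iio (N + r))
    by_cases hn : n < N + r
    · exact Submodule.subset_span ⟨n, hn, rfl⟩
    obtain ⟨k, rfl⟩ : ∃ k, n = k + r := ⟨n - r, by omega⟩
    obtain ⟨c, hc, hmem⟩ := h k (by omega)
    have hle : Submodule.span K (u '' Set.Iio (k + r)) ≤
        (W.restrictScalars K).comap (Module.AEval'.of α).toLinearMap := by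
      rw [Submodule.span_le]
      rintro _ ⟨j, hj, rfl⟩
      exact ih j hj
    have h1 : Module.AEval'.of α (α (u k) - c • u (k + r)) ∈ W := hle hmem
    have h2 : Module.AEval'.of α (α (u k)) ∈ W := by
      rw [← Module.AEval'.X_smul_of]
      exact W.smul_mem _ (ih k (by omega))
    have h3 : c • Module.AEval'.of α (u (k + r)) ∈ W.restrictScalars K := by
      have := sub_mem h2 h1
      rw [← map_sub, sub_sub_cancel, map_smul] at this
      exact this
    exact ((W.restrictScalars K).smul_mem_iff hc).1 h3

lemma finite_aeval_of_action {C : Type*} [Ring C] [Algebra K C] (c : C) (α : Module.End K U)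
    (S : C →ₗ[K] Module.End K U) (hS : ∀ b, S (c * b) = α * S b)
    (hcomm : ∀ b, S b * α = α * S b) (u : ℕ → U) (k : ℕ)
    (hgen : ∀ n, Module.AEval'.of α (u n) ∈
      Submodule.span K[X] ((fun j => Module.AEval'.of α (u j)) '' Set.Iio k))
    (hmem : ∀ b n, S b (u n) ∈ Submodule.span K (Set.range u))
    (hinj : ∀ b, (∀ n, S b (u n) = 0) → b = 0) :
    Module.Finite K[X] (Module.AEval K C c) := by
  set W := Submodule.span K[X] ((fun j => Module.AEval'.of α (u j)) '' Set.Iio k) with hW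
  have hfin : Module.Finite K[X] W :=
    Module.Finite.iff_fg.2 (Submodule.fg_span ((Set.finite_Iio k).image _))
  have hle : Submodule.span K (Set.range u) ≤
      (W.restrictScalars K).comap (Module.AEval'.of α).toLinearMap := by
    rw [Submodule.span_le]
    rintro _ ⟨j, rfl⟩
    exact hgen j
  let T : C →ₗ[K] (Fin k → W) :=
    { toFun := fun b j => ⟨Module.AEval'.of α (S b (u j)), hle (hmem b j)⟩
      map_add' := fun b b' => by ext j; simp
      map_smul' := fun t b => by ext j; simp }
  have hT : ∀ b : C, T (c • b) = (X : K[X]) • T b := by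
    intro b
    ext j
    simp [T, hS, Module.AEval'.X_smul_of]
  let T' : Module.AEval K C c →ₗ[K[X]] (Fin k → W) := LinearMap.ofAEval c T hT
  have hT' : Function.Injective T' := by
    rw [← LinearMap.ker_eq_bot, LinearMap.ker_eq_bot']
    intro m hm
    obtain ⟨b, rfl⟩ := (Module.AEval.of K C c).surjective m
    have hb : T b = 0 := hm
    rw [hinj b, map_zero]
    let β : Module.AEval' α →ₗ[K[X]] Module.AEval' α :=
      LinearMap.ofAEval α ((Module.AEval'.of α).toLinearMap ∘ₗ S b) (by
        intro x
        have := congrArg (fun f : Module.End K U => f x) (hcomm b)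
        simp only [Module.End.mul_apply] at this
        simp [Module.AEval'.X_smul_of, this])
    have hβ : ∀ x, β (Module.AEval'.of α x) = Module.AEval'.of α (S b x) := fun x => rfl
    have hker : W ≤ LinearMap.ker β := by
      rw [hW, Submodule.span_le]
      rintro _ ⟨j, hj, rfl⟩
      have := congrArg Subtype.val (congrFun hb ⟨j, hj⟩)
      exact this
    intro n
    have := hker (hgen n)
    rw [LinearMap.mem_ker, hβ] at this
    exact (LinearEquiv.map_eq_zero_iff _).1 this
  have := isNoetherian_of_injective T' hT'
  infer_instance

end FiniteCentralizer

lemma not_isNoetherianRing_of_orthogonal {R : Type*} [Ring R] (e : ℕ → R)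
    (he : ∀ n, e n * e n = e n) (hne : ∀ n, e n ≠ 0) (ho : ∀ m n, m ≠ n → e m * e n = 0) :
    ¬ IsNoetherianRing R := by
  intro h
  obtain ⟨n, hn⟩ := monotone_stabilizes_iff_noetherian.2 h
    ⟨fun n => Submodule.span R (e '' Set.Iio n), fun m n hmn =>
      Submodule.span_mono (Set.image_mono (Set.Iio_subset_Iio hmn))⟩
  have hmem : e n ∈ Submodule.span R (e '' Set.Iio n) := by
    have h1 : Submodule.span R (e '' Set.Iio n) = Submodule.span R (e '' Set.Iio (n + 1)) :=
      hn (n + 1) (by omega)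
    rw [h1]
    exact Submodule.subset_span ⟨n, by simp, rfl⟩
  have hker : Submodule.span R (e '' Set.Iio n) ≤ LinearMap.ker (rmulMap R (e n)) := by
    rw [Submodule.span_le]
    rintro _ ⟨j, hj, rfl⟩
    exact ho j n (ne_of_lt hj)
  have h2 : e n * e n = 0 := hker hmem
  exact hne n (by rw [← he n, h2])

/-- The divided power `x ^ k / k!`, taken to be zero for negative `k`. -/
def dpow (k : ℤ) : K[X] := if 0 ≤ k then monomial k.toNat ((k.toNat ! : K))⁻¹ else 0

lemma dpow_natCast (n : ℕ) : dpow K n = monomial n ((n ! : K))⁻¹ := by simp [dpow]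

lemma dpow_of_neg {k : ℤ} (hk : k < 0) : dpow K k = 0 := by simp [dpow, hk]

lemma derOp_dpow (k : ℤ) : derOp K (dpow K k) = dpow K (k - 1) := by
  rcases lt_or_ge k 0 with hk | hk
  · rw [dpow_of_neg K hk, dpow_of_neg K (by omega), map_zero]
  lift k to ℕ using hk
  rcases k with _ | n
  · rw [dpow_natCast, dpow_of_neg K (by simp)]
    simp [derOp]
  · rw [dpow_natCast, show ((n + 1 : ℕ) : ℤ) - 1 = (n : ℤ) by push_cast; ring, dpow_natCast]
    have : ((n : K) + 1) ≠ 0 := by exact_mod_cast n.succ_ne_zero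
    have h2 : (n ! : K) ≠ 0 := by exact_mod_cast n.factorial_ne_zero
    simp only [derOp, derivative_monomial, Nat.factorial_succ]
    push_cast
    congr 1
    field_simp

lemma xOp_dpow (k : ℤ) : xOp K (dpow K k) = ((k : K) + 1) • dpow K (k + 1) := by
  rcases lt_or_ge k 0 with hk | hk
  · rw [dpow_of_neg K hk, map_zero]
    rcases eq_or_ne k (-1) with rfl | h
    · simp
    · rw [dpow_of_neg K (by omega), smul_zero]
  lift k to ℕ using hk
  rw [show ((k : ℤ) + 1) = ((k + 1 : ℕ) : ℤ) by push_cast; ring, dpow_natCast, dpow_natCast]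
  have : ((k : K) + 1) ≠ 0 := by exact_mod_cast k.succ_ne_zero
  have h2 : (k ! : K) ≠ 0 := by exact_mod_cast k.factorial_ne_zero
  simp only [xOp, LinearMap.mulLeft_apply, X_mul_monomial, smul_monomial, Nat.factorial_succ]
  congr 1
  push_cast
  simp only [smul_eq_mul]
  field_simp

lemma intOp_dpow {k : ℤ} (hk : k ≠ -1) : intOp K (dpow K k) = dpow K (k + 1) := by
  rcases lt_or_ge k 0 with h | h
  · rw [dpow_of_neg K h, dpow_of_neg K (by omega), map_zero]
  lift k to ℕ using h
  rw [show ((k : ℤ) + 1) = ((k + 1 : ℕ) : ℤ) by push_cast; ring, dpow_natCast, dpow_natCast]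
  have : ((k : K) + 1) ≠ 0 := by exact_mod_cast k.succ_ne_zero
  have h2 : (k ! : K) ≠ 0 := by exact_mod_cast k.factorial_ne_zero
  have h3 : intOp K (monomial k 1) = ((k : K) + 1)⁻¹ • X ^ (k + 1) := by
    have := (Polynomial.basisMonomials K).constr_basis K
      (fun n => ((n : K) + 1)⁻¹ • (X : K[X]) ^ (n + 1)) k
    simpa [intOp] using this
  rw [← mul_one ((k ! : K)⁻¹), ← smul_eq_mul, ← smul_monomial, map_smul, h3, smul_smul,
    ← monomial_one_right_eq_X_pow, smul_monomial]
  congr 1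
  simp only [Nat.factorial_succ]
  push_cast
  simp only [smul_eq_mul]
  field_simp

lemma hOp_dpow (n : ℕ) : hOp K (dpow K n) = ((n : K) + 1) • dpow K n := by
  rw [hOp, Module.End.mul_apply, xOp_dpow, map_smul, derOp_dpow]
  simp

variable {K} in
lemma ext_dpow {M : Type*} [AddCommGroup M] [Module K M] {f g : K[X] →ₗ[K] M}
    (h : ∀ n : ℕ, f (dpow K n) = g (dpow K n)) : f = g := by
  refine Polynomial.lhom_ext' fun n => LinearMap.ext_ring ?_
  have h1 := h n
  have h2 : (n ! : K) ≠ 0 := by exact_mod_cast n.factorial_ne_zero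
  have h3 : monomial n (1 : K) = (n ! : K) • dpow K n := by
    rw [dpow_natCast, smul_monomial, smul_eq_mul, mul_inv_cancel₀ h2]
  simp only [LinearMap.comp_apply, h3, map_smul, h1]

/-- The coordinate functional dual to the divided power `x ^ m / m!`. -/
def dcoord (m : ℕ) : Module.Dual K K[X] := (m ! : K) • lcoeff K m

lemma dcoord_dpow (m : ℕ) (k : ℤ) : dcoord K m (dpow K k) = if k = m then 1 else 0 := by
  rcases lt_or_ge k 0 with h | h
  · rw [dpow_of_neg K h, map_zero, if_neg (by omega)]
  lift k to ℕ using h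
  have h2 : (m ! : K) ≠ 0 := by exact_mod_cast m.factorial_ne_zero
  rw [dpow_natCast]
  simp only [dcoord, LinearMap.smul_apply, lcoeff_apply, coeff_monomial, Nat.cast_inj]
  split_ifs with hkm
  · subst hkm
    simp [h2]
  · simp

variable {K} in
lemma eq_zero_of_dcoord {f : K[X]} (h : ∀ m, dcoord K m f = 0) : f = 0 := by
  ext m
  have h2 : (m ! : K) ≠ 0 := by exact_mod_cast m.factorial_ne_zero
  have := h m
  simpa [dcoord, h2] using this

lemma mem_span_dpow (f : K[X]) : f ∈ Submodule.span K (Set.range fun n : ℕ => dpow K n) := by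
  set W := Submodule.span K (Set.range fun n : ℕ => dpow K n)
  have : W.mkQ = 0 := ext_dpow fun n => by
    simpa using Submodule.subset_span (Set.mem_range_self n)
  rw [← Submodule.Quotient.mk_eq_zero, ← Submodule.mkQ_apply, this, LinearMap.zero_apply]

variable {K} in
lemma sum_smulRight {M : Type*} [AddCommGroup M] [Module K M] {f : K[X] →ₗ[K] M} {N : ℕ}
    (h : ∀ n : ℕ, N ≤ n → f (dpow K n) = 0) :
    f = ∑ n ∈ Finset.range N, (dcoord K n).smulRight (f (dpow K n)) := by
  refine ext_dpow fun k => ?_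
  simp only [LinearMap.sum_apply, LinearMap.smulRight_apply, dcoord_dpow, Nat.cast_inj, ite_smul,
    one_smul, zero_smul, Finset.sum_ite_eq, Finset.mem_range]
  split_ifs with hk
  · rfl
  · exact h k (by omega)

variable {K} in
lemma mem_span_dcoord {f : Module.Dual K K[X]} {N : ℕ}
    (h : ∀ n : ℕ, N ≤ n → f (dpow K n) = 0) :
    f ∈ Submodule.span K (dcoord K '' Set.Iio N) := by
  rw [sum_smulRight h]
  refine Submodule.sum_mem _ fun n hn => ?_
  have : (dcoord K n).smulRight (f (dpow K n)) = f (dpow K n) • dcoord K n := by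
    ext; simp [mul_comm]
  rw [this]
  exact Submodule.smul_mem _ _ (Submodule.subset_span ⟨n, by simpa using hn, rfl⟩)

lemma derOp_pow_dpow (j : ℕ) (k : ℤ) : (derOp K ^ j) (dpow K k) = dpow K (k - j) := by
  induction j with
  | zero => simp
  | succ j ih =>
    rw [pow_succ', Module.End.mul_apply, ih, derOp_dpow]
    congr 1; push_cast; ring

lemma intOp_pow_dpow (i : ℕ) {k : ℤ} (hk : 0 ≤ k) : (intOp K ^ i) (dpow K k) = dpow K (k + i) := by
  induction i with
  | zero => simp
  | succ i ih =>
    rw [pow_succ', Module.End.mul_apply, ih, intOp_dpow K (by omega)]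
    congr 1; push_cast; ring

lemma eOp_eq (i j : ℕ) : eOp K i j = (dcoord K j).smulRight (dpow K i) := by
  refine ext_dpow fun k => ?_
  simp only [eOp, LinearMap.sub_apply, Module.End.mul_apply, derOp_pow_dpow,
    LinearMap.smulRight_apply, dcoord_dpow]
  rcases lt_trichotomy k j with h | rfl | h
  · rw [dpow_of_neg K (by omega), dpow_of_neg K (by omega), if_neg (by omega)]
    simp
  · rw [dpow_of_neg K (k := (k : ℤ) - ((k + 1 : ℕ) : ℤ)) (by omega), intOp_pow_dpow K _ (by omega)]
    simp
  · rw [intOp_pow_dpow K _ (by omega), intOp_pow_dpow K _ (by omega), if_neg (by omega)]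
    rw [zero_smul, sub_eq_zero]
    congr 1; push_cast; ring

variable {K} in
lemma mem_Fset_of_eventually_zero {f : Module.End K K[X]} {N : ℕ}
    (h : ∀ n : ℕ, N ≤ n → f (dpow K n) = 0) : f ∈ Fset K := by
  rw [sum_smulRight h]
  refine Submodule.sum_mem _ fun n _ => ?_
  have hle : Submodule.span K (Set.range fun n : ℕ => dpow K n) ≤
      (Fset K).comap (LinearMap.smulRightₗ (dcoord K n)) := by
    rw [Submodule.span_le]
    rintro _ ⟨i, rfl⟩
    exact Submodule.subset_span ⟨i, n, (eOp_eq K i n).symm⟩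
  exact hle (mem_span_dpow K _)

variable {K} in
lemma exists_of_mem_Fset {f : Module.End K K[X]} (hf : f ∈ Fset K) :
    ∃ N, ∀ n : ℕ, N ≤ n → f (dpow K n) = 0 ∧ dcoord K n ∘ₗ f = 0 := by
  induction hf using Submodule.span_induction with
  | mem f hf =>
    obtain ⟨i, j, rfl⟩ := hf
    refine ⟨i + j + 1, fun n hn => ⟨?_, ?_⟩⟩
    · rw [eOp_eq, LinearMap.smulRight_apply, dcoord_dpow, if_neg (by omega), zero_smul]
    · ext1
      rw [eOp_eq]
      ext
      simp [dcoord_dpow, show i ≠ n by omega]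
  | zero => exact ⟨0, by simp⟩
  | add f g _ _ hf hg =>
    obtain ⟨N, hN⟩ := hf
    obtain ⟨M, hM⟩ := hg
    refine ⟨N + M, fun n hn => ?_⟩
    obtain ⟨h1, h2⟩ := hN n (by omega)
    obtain ⟨h3, h4⟩ := hM n (by omega)
    simp [LinearMap.comp_add, h1, h2, h3, h4]
  | smul t f _ hf =>
    obtain ⟨N, hN⟩ := hf
    refine ⟨N, fun n hn => ?_⟩
    obtain ⟨h1, h2⟩ := hN n hn
    simp [LinearMap.comp_smul, h1, h2]

/-- The value at `x ^ n / n!` of the operator whose `i`-th diagonal is given by the polynomial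
`p i`. -/
def diagSum (p : ℤ →₀ K[X]) (n : ℕ) : K[X] :=
  p.sum fun i q => q.eval (n : K) • dpow K (n + i)

lemma diagSum_add (p q : ℤ →₀ K[X]) (n : ℕ) :
    diagSum K (p + q) n = diagSum K p n + diagSum K q n :=
  Finsupp.sum_add_index' (by simp) (by simp [add_smul])

lemma diagSum_single (i : ℤ) (q : K[X]) (n : ℕ) :
    diagSum K (Finsupp.single i q) n = q.eval (n : K) • dpow K (n + i) :=
  Finsupp.sum_single_index (by simp)

lemma dcoord_diagSum (p : ℤ →₀ K[X]) (m n : ℕ) :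
    dcoord K m (diagSum K p n) = (p (m - n)).eval (n : K) := by
  induction p using Finsupp.induction_linear with
  | zero => simp [diagSum]
  | add p q hp hq => simp [diagSum_add, hp, hq]
  | single i q =>
    rw [diagSum_single, map_smul, dcoord_dpow, Finsupp.single_apply]
    by_cases h : i = m - n
    · rw [if_pos h, if_pos (by omega)]; simp
    · rw [if_neg h, if_neg (by omega)]; simp

variable {K} in
/-- If `g` acts on single diagonals eventually as a diagonal operator, then it does so on all
finite sums of diagonals. -/
lemma eventually_diagSum_of_single {g : Module.End K K[X]}
    (h : ∀ (i : ℤ) (q : K[X]), ∃ p' : ℤ →₀ K[X], ∀ᶠ n : ℕ in atTop,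
      g (q.eval (n : K) • dpow K (n + i)) = diagSum K p' n) (p : ℤ →₀ K[X]) :
    ∃ p' : ℤ →₀ K[X], ∀ᶠ n : ℕ in atTop, g (diagSum K p n) = diagSum K p' n := by
  induction p using Finsupp.induction_linear with
  | zero => exact ⟨0, by simp [diagSum]⟩
  | add p q hp hq =>
    obtain ⟨p', hp⟩ := hp
    obtain ⟨q', hq⟩ := hq
    refine ⟨p' + q', ?_⟩
    filter_upwards [hp, hq] with n h1 h2
    rw [diagSum_add, diagSum_add, map_add, h1, h2]
  | single i q => simpa only [diagSum_single] using h i q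

variable {K} in
lemma eventually_diagSum {g : Module.End K K[X]} (hg : g ∈ I1 K) :
    ∀ p : ℤ →₀ K[X], ∃ p' : ℤ →₀ K[X],
      ∀ᶠ n : ℕ in atTop, g (diagSum K p n) = diagSum K p' n := by
  induction hg using Algebra.adjoin_induction with
  | mem g hg =>
    refine eventually_diagSum_of_single fun i q => ?_
    simp only [Set.mem_insert_iff, Set.mem_singleton_iff] at hg
    rcases hg with rfl | rfl | rfl
    · refine ⟨Finsupp.single (i + 1) (q * (X + C ((i : K) + 1))), .of_forall fun n => ?_⟩
      rw [diagSum_single, map_smul, xOp_dpow, smul_smul, add_assoc]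
      congr 1
      simp [add_assoc]
    · refine ⟨Finsupp.single (i - 1) q, .of_forall fun n => ?_⟩
      rw [diagSum_single, map_smul, derOp_dpow, add_sub_assoc]
    · refine ⟨Finsupp.single (i + 1) q, ?_⟩
      filter_upwards [eventually_ge_atTop i.natAbs] with n hn
      rw [diagSum_single, map_smul, intOp_dpow K (by omega), add_assoc]
  | algebraMap t =>
    refine eventually_diagSum_of_single fun i q => ⟨Finsupp.single i (C t * q), ?_⟩
    refine .of_forall fun n => ?_
    rw [diagSum_single, Module.algebraMap_end_apply, smul_smul, eval_mul, eval_C]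
  | add g g' _ _ hg hg' =>
    intro p
    obtain ⟨p₁, h₁⟩ := hg p
    obtain ⟨p₂, h₂⟩ := hg' p
    refine ⟨p₁ + p₂, ?_⟩
    filter_upwards [h₁, h₂] with n h1 h2
    rw [diagSum_add, LinearMap.add_apply, h1, h2]
  | mul g g' _ _ hg hg' =>
    intro p
    obtain ⟨p₁, h₁⟩ := hg' p
    obtain ⟨p₂, h₂⟩ := hg p₁
    refine ⟨p₂, ?_⟩
    filter_upwards [h₁, h₂] with n h1 h2
    rw [Module.End.mul_apply, h1, h2]

variable {K} in
lemma exists_diagSum {g : Module.End K K[X]} (hg : g ∈ I1 K) :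
    ∃ p : ℤ →₀ K[X], ∃ N, ∀ n : ℕ, N ≤ n → g (dpow K n) = diagSum K p n := by
  obtain ⟨p, hp⟩ := eventually_diagSum hg (Finsupp.single 0 1)
  obtain ⟨N, hN⟩ := eventually_atTop.1 hp
  refine ⟨p, N, fun n hn => ?_⟩
  simpa [diagSum_single] using hN n hn

lemma self_mem_Cen {a : Module.End K K[X]} (haI : a ∈ I1 K) : a ∈ Cen K a :=
  ⟨haI, Subalgebra.mem_centralizer_iff K |>.2 (by simp)⟩

variable {K} in
lemma mem_Cen_iff {a b : Module.End K K[X]} : b ∈ Cen K a ↔ b ∈ I1 K ∧ a * b = b * a := by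
  simp [Cen, Algebra.mem_inf, Subalgebra.mem_centralizer_iff]

variable {K} in
lemma exists_orthogonal_of_mem {a : Module.End K K[X]}
    (h : a ∈ Subalgebra.toSubmodule (KH K) ⊔ Fset K) :
    ∃ e : ℕ → Cen K a, (∀ n, e n * e n = e n) ∧ (∀ n, e n ≠ 0) ∧
      ∀ m n, m ≠ n → e m * e n = 0 := by
  obtain ⟨b, hb, f, hf, rfl⟩ := Submodule.mem_sup.1 h
  rw [Subalgebra.mem_toSubmodule, KH, Algebra.adjoin_singleton_eq_range_aeval] at hb
  obtain ⟨q, rfl⟩ := hb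
  obtain ⟨N, hN⟩ := exists_of_mem_Fset hf
  have hdiag : ∀ n : ℕ, (aeval (hOp K) q) (dpow K n) = q.eval ((n : K) + 1) • dpow K n := by
    intro n
    refine Module.End.aeval_apply_of_hasEigenvector
      ⟨Module.End.mem_eigenspace_iff.2 (hOp_dpow K n), fun h0 => ?_⟩
    have := dcoord_dpow K n n
    simp [h0] at this
  have hcoord : ∀ n : ℕ, dcoord K n ∘ₗ (aeval (hOp K) q) = q.eval ((n : K) + 1) • dcoord K n := by
    intro n
    refine ext_dpow fun k => ?_
    rw [LinearMap.comp_apply, hdiag, map_smul, LinearMap.smul_apply, dcoord_dpow]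
    by_cases hk : k = n
    · rw [hk]
    · simp [hk]
  have hmem : ∀ n, eOp K (N + n) (N + n) ∈ Cen K (aeval (hOp K) q + f) := by
    intro n
    refine mem_Cen_iff.2 ⟨eOp_mem K _ _, ?_⟩
    obtain ⟨h1, h2⟩ := hN (N + n) (by omega)
    rw [eOp_eq]
    ext1
    ext1
    simp only [LinearMap.comp_apply, Module.End.mul_apply, LinearMap.smulRight_apply, map_smul,
      LinearMap.add_apply, h1, hdiag, add_zero]
    have h3 := fun x => LinearMap.congr_fun (hcoord (N + n)) x
    have h4 := fun x => LinearMap.congr_fun h2 x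
    simp only [LinearMap.comp_apply, LinearMap.smul_apply, LinearMap.zero_apply] at h3 h4
    rw [map_add, h3, h4, add_zero, smul_smul, smul_eq_mul, mul_comm]
  refine ⟨fun n => ⟨_, hmem n⟩, fun n => ?_, fun n h0 => ?_, fun m n hmn => ?_⟩
  · ext1
    refine LinearMap.ext fun x => ?_
    simp [eOp_eq, dcoord_dpow]
  · have h1 := congrArg (fun b : Cen K _ => dcoord K (N + n) (b.1 (dpow K (N + n : ℕ)))) h0
    simp [eOp_eq, dcoord_dpow] at h1
  · ext1
    refine LinearMap.ext fun x => ?_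
    simp [eOp_eq, dcoord_dpow, hmn.symm]

variable {K} in
lemma eventually_eval_ne_zero {q : K[X]} (hq : q ≠ 0) :
    ∃ N, ∀ n : ℕ, N ≤ n → q.eval (n : K) ≠ 0 := by
  have hfin : {n : ℕ | q.IsRoot (n : K)}.Finite :=
    (Polynomial.finite_setOfPred_isRoot hq).preimage Nat.cast_injective.injOn
  obtain ⟨N, hN⟩ := hfin.bddAbove
  exact ⟨N + 1, fun n hn h0 => absurd (hN h0) (by omega)⟩

variable {K} in
lemma diagSum_sub_mem_span (p : ℤ →₀ K[X]) (r : ℕ) (hmax : ∀ i ∈ p.support, i ≤ r) (n : ℕ) :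
    diagSum K p n - (p r).eval (n : K) • dpow K (n + r : ℕ) ∈
      Submodule.span K ((fun k : ℕ => dpow K k) '' Set.Iio (n + r)) := by
  have hsum : diagSum K p n - (p r).eval (n : K) • dpow K (n + r : ℕ) =
      diagSum K (p.erase r) n := by
    rw [sub_eq_iff_eq_add', Nat.cast_add, ← diagSum_single, ← diagSum_add,
      Finsupp.single_add_erase]
  rw [hsum]
  refine Submodule.sum_mem _ fun i hi => Submodule.smul_mem _ _ ?_
  rw [Finsupp.support_erase, Finset.mem_erase] at hi
  have h1 := hmax i hi.2
  rcases lt_or_ge ((n : ℤ) + i) 0 with h | h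
  · rw [dpow_of_neg K h]
    exact zero_mem _
  · have hlt : (n : ℤ) + i < n + r := by have := hi.1; omega
    lift (n : ℤ) + i to ℕ using h with k
    exact Submodule.subset_span ⟨k, by simp only [Set.mem_Iio]; omega, rfl⟩

variable {K} in
lemma exists_dcoord_comp_eq_zero {b : Module.End K K[X]} (hb : b ∈ I1 K) (m : ℕ) :
    ∃ N, ∀ n : ℕ, N ≤ n → (dcoord K m ∘ₗ b) (dpow K n) = 0 := by
  obtain ⟨p, N, hp⟩ := exists_diagSum hb
  obtain ⟨L, hL⟩ := p.support.bddBelow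
  refine ⟨N + m + L.natAbs + 1, fun n hn => ?_⟩
  rw [LinearMap.comp_apply, hp n (by omega), dcoord_diagSum]
  have : p (m - n) = 0 := by
    by_contra h
    have := hL (Finsupp.mem_support_iff.2 h)
    omega
  rw [this, eval_zero]

lemma finite_Cen_of_raising {a : Module.End K K[X]} (haI : a ∈ I1 K) {p : ℤ →₀ K[X]} {N : ℕ}
    (hp : ∀ n : ℕ, N ≤ n → a (dpow K n) = diagSum K p n) {i : ℤ} (hi : 0 < i) (hpi : p i ≠ 0) :
    Module.Finite K[X] (Module.AEval K (Cen K a) (⟨a, self_mem_Cen K haI⟩ : Cen K a)) := by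
  obtain ⟨r, hr, hrmax⟩ := p.support.exists_max_image id ⟨i, Finsupp.mem_support_iff.2 hpi⟩
  have hir : i ≤ r := hrmax i (Finsupp.mem_support_iff.2 hpi)
  lift r to ℕ using by omega
  obtain ⟨M, hM⟩ := eventually_eval_ne_zero (Finsupp.mem_support_iff.1 hr)
  refine finite_aeval_of_action (C := Cen K a) ⟨a, _⟩ a (Cen K a).val.toLinearMap (fun b => rfl)
    (fun b => (mem_Cen_iff.1 b.2).2.symm) (fun n : ℕ => dpow K n) (N + M + r)
    (mem_span_of_shift a (fun n : ℕ => dpow K n) r (N + M) (by omega) fun n hn =>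
      ⟨_, hM n (by omega), ?_⟩) (fun b n => mem_span_dpow K _) fun b hb => ?_
  · rw [hp n (by omega)]
    exact diagSum_sub_mem_span p r hrmax n
  · exact Subtype.ext (ext_dpow hb)

lemma finite_Cen_of_lowering {a : Module.End K K[X]} (haI : a ∈ I1 K) {p : ℤ →₀ K[X]} {N : ℕ}
    (hp : ∀ n : ℕ, N ≤ n → a (dpow K n) = diagSum K p n) {i : ℤ} (hi : i < 0) (hpi : p i ≠ 0) :
    Module.Finite K[X] (Module.AEval K (Cen K a) (⟨a, self_mem_Cen K haI⟩ : Cen K a)) := by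
  obtain ⟨r, hr, hrmin⟩ := p.support.exists_min_image id ⟨i, Finsupp.mem_support_iff.2 hpi⟩
  have hir : r ≤ i := hrmin i (Finsupp.mem_support_iff.2 hpi)
  obtain ⟨s, rfl⟩ : ∃ s : ℕ, r = -s := ⟨r.natAbs, by omega⟩
  obtain ⟨M, hM⟩ := eventually_eval_ne_zero (Finsupp.mem_support_iff.1 hr)
  let S : Module.End K K[X] →ₗ[K] Module.End K (Module.Dual K K[X]) := Module.Dual.transpose
  have hS : ∀ b f, S b f = f ∘ₗ b := fun b f => rfl
  have hcomm : ∀ b : Cen K a, S b * S a = S a * S b := by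
    intro b
    refine LinearMap.ext fun f => ?_
    simp only [Module.End.mul_apply, hS, LinearMap.comp_assoc]
    exact congrArg (f ∘ₗ ·) (mem_Cen_iff.1 b.2).2
  refine finite_aeval_of_action (C := Cen K a) ⟨a, _⟩ (S a) (S ∘ₗ (Cen K a).val.toLinearMap)
    (fun b => ?_) hcomm (dcoord K) (N + M + s)
    (mem_span_of_shift (S a) (dcoord K) s (N + M) (by omega) fun m hm =>
      ⟨_, hM (m + s) (by omega), mem_span_dcoord fun n hn => ?_⟩) (fun b m => ?_) fun b hb => ?_
  · exact hcomm b
  · rw [LinearMap.sub_apply, hS, LinearMap.comp_apply, hp n (by omega), dcoord_diagSum,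
      LinearMap.smul_apply, dcoord_dpow]
    rcases hn.eq_or_lt with rfl | hlt
    · simp
    · have : p (m - n) = 0 := by
        by_contra h
        have := hrmin _ (Finsupp.mem_support_iff.2 h)
        simp only [id] at this
        omega
      rw [this, if_neg (by omega)]
      simp
  · obtain ⟨L, hL⟩ := exists_dcoord_comp_eq_zero b.2.1 m
    exact Submodule.span_mono (Set.image_subset_range _ _) (mem_span_dcoord hL)
  · refine Subtype.ext (LinearMap.ext fun x => eq_zero_of_dcoord fun m => ?_)
    exact LinearMap.congr_fun (hb m) x

lemma mem_of_diagonal {a : Module.End K K[X]} {p : ℤ →₀ K[X]} {N : ℕ}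
    (hp : ∀ n : ℕ, N ≤ n → a (dpow K n) = diagSum K p n) (h0 : ∀ i ≠ 0, p i = 0) :
    a ∈ Subalgebra.toSubmodule (KH K) ⊔ Fset K := by
  have hp0 : p = Finsupp.single 0 (p 0) := by
    ext1 i
    rcases eq_or_ne i 0 with rfl | hi
    · simp
    · simp [h0 i hi, hi.symm]
  set q := (p 0).comp (X - 1)
  refine Submodule.mem_sup.2 ⟨aeval (hOp K) q, ?_, a - aeval (hOp K) q,
    mem_Fset_of_eventually_zero (N := N) fun n hn => ?_, by abel⟩
  · rw [Subalgebra.mem_toSubmodule]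
    exact aeval_mem_adjoin_singleton K _
  · rw [LinearMap.sub_apply, hp n hn, hp0, diagSum_single, add_zero, sub_eq_zero, eq_comm,
      Module.End.aeval_apply_of_hasEigenvector (μ := (n : K) + 1)
        ⟨Module.End.mem_eigenspace_iff.2 (hOp_dpow K n), fun h0 => ?_⟩]
    · simp [q]
    · have := dcoord_dpow K n n
      simp [h0] at this

lemma finite_Cen {a : Module.End K K[X]} (haI : a ∈ I1 K)
    (ha : a ∉ Subalgebra.toSubmodule (KH K) ⊔ Fset K) :
    Module.Finite K[X] (Module.AEval K (Cen K a) (⟨a, self_mem_Cen K haI⟩ : Cen K a)) := by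
  obtain ⟨p, N, hp⟩ := exists_diagSum haI
  by_cases h0 : ∀ i ≠ 0, p i = 0
  · exact absurd (mem_of_diagonal K hp h0) ha
  push Not at h0
  obtain ⟨i, hi, hpi⟩ := h0
  rcases hi.lt_or_gt with hi | hi
  · exact finite_Cen_of_lowering K haI hp hi hpi
  · exact finite_Cen_of_raising K haI hp hi hpi

lemma noetherian_of_finite_aeval {C : Type*} [Ring C] [Algebra K C] (c : C)
    (hc : ∀ b, c * b = b * c) (hfin : Module.Finite K[X] (Module.AEval K C c)) :
    Algebra.FiniteType K C ∧ IsNoetherianRing C ∧ IsNoetherianRing Cᵐᵒᵖ := by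
  let _ : Algebra K[X] C := (aeval c : K[X] →ₐ[K] C).toRingHom.toAlgebra' fun q b => by
    exact (Algebra.commute_of_mem_adjoin_singleton_of_commute
      (aeval_mem_adjoin_singleton K c) (hc b).symm).eq.symm
  have hsmul : ∀ (q : K[X]) (b : C), q • b = aeval c q * b := fun q b => rfl
  have : IsScalarTower K K[X] C := IsScalarTower.of_algebraMap_eq fun t => by
    change _ = aeval c (Polynomial.C t)
    simp
  let e : Module.AEval K C c ≃ₗ[K[X]] C :=
    { (Module.AEval.of K C c).symm with
      map_smul' := fun q m => by
        obtain ⟨b, rfl⟩ := (Module.AEval.of K C c).surjective m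
        simp [← Module.AEval.of_aeval_smul, hsmul] }
  have : Module.Finite K[X] C := Module.Finite.equiv e
  exact ⟨Algebra.FiniteType.trans (S := K[X]) inferInstance inferInstance,
    IsNoetherianRing.of_finite K[X] C, IsNoetherianRing.of_finite K[X] Cᵐᵒᵖ⟩

lemma finite_aeval_Cen_iff {a : Module.End K K[X]} (haI : a ∈ I1 K) :
    Module.Finite K[X] (Module.AEval K (Cen K a) (⟨a, self_mem_Cen K haI⟩ : Cen K a)) ↔
      ∃ (n : ℕ) (g : Fin n → Module.End K K[X]), (∀ i, g i ∈ Cen K a) ∧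
        ∀ c ∈ Cen K a, ∃ p : Fin n → K[X], c = ∑ i, aeval a (p i) * g i := by
  set a' : Cen K a := ⟨a, self_mem_Cen K haI⟩ with ha'
  have hval : ∀ {n : ℕ} (p : Fin n → K[X]) (g : Fin n → Cen K a),
      (((Module.AEval.of K (Cen K a) a').symm
        (∑ i, p i • Module.AEval.of K (Cen K a) a' (g i)) : Cen K a) : Module.End K K[X]) =
      ∑ i, aeval a (p i) * (g i : Module.End K K[X]) := by
    intro n p g
    have h1 : ∀ q : K[X], ((aeval a' q : Cen K a) : Module.End K K[X]) = aeval a q :=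
      fun q => (aeval_algHom_apply (Cen K a).val a' q).symm
    simp [← Module.AEval.of_aeval_smul, h1]
  constructor
  · intro hfin
    obtain ⟨n, s, hs⟩ := Module.Finite.exists_fin (R := K[X]) (M := Module.AEval K (Cen K a) a')
    refine ⟨n, fun i => ((Module.AEval.of K (Cen K a) a').symm (s i) : Cen K a),
      fun i => Subtype.property _, fun c hc => ?_⟩
    have hmem : Module.AEval.of K (Cen K a) a' ⟨c, hc⟩ ∈ Submodule.span K[X] (Set.range s) :=
      hs ▸ Submodule.mem_top
    obtain ⟨p, hp⟩ := (Submodule.mem_span_range_iff_exists_fun K[X]).1 hmem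
    refine ⟨p, ?_⟩
    rw [← hval]
    simp [hp]
  · rintro ⟨n, g, hg, h⟩
    refine Module.finite_def.2 (Submodule.fg_iff_exists_fin_generating_family.2
      ⟨n, fun i => Module.AEval.of K (Cen K a) a' ⟨g i, hg i⟩, ?_⟩)
    rw [eq_top_iff]
    intro m _
    obtain ⟨c, rfl⟩ := (Module.AEval.of K (Cen K a) a').surjective m
    obtain ⟨p, hp⟩ := h c c.2
    refine (Submodule.mem_span_range_iff_exists_fun K[X]).2 ⟨p, ?_⟩
    rw [← LinearEquiv.symm_apply_eq, eq_comm]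
    exact Subtype.ext (hp.trans (hval p fun i => ⟨g i, hg i⟩).symm)

/-- for a non-scalar `a ∈ I₁`, the conditions (1) `a ∉ K[H]+F`,
(2) `Cen_{I₁}(a)` is a finitely generated `K[a]`-module, (3) `Cen_{I₁}(a)` is left
Noetherian, (4) `Cen_{I₁}(a)` is right Noetherian, (5) `Cen_{I₁}(a)` is a finitely
generated Noetherian algebra, are all equivalent. -/
theorem statement15 (a : Module.End K (Polynomial K)) (haI : a ∈ I1 K)
    (ha : a ∉ Set.range (algebraMap K (Module.End K (Polynomial K)))) :
    ((a ∉ Subalgebra.toSubmodule (KH K) ⊔ Fset K) ↔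
        (∃ (n : ℕ) (g : Fin n → Module.End K (Polynomial K)),
          (∀ i, g i ∈ Cen K a) ∧
          ∀ c ∈ Cen K a, ∃ p : Fin n → Polynomial K,
            c = ∑ i, Polynomial.aeval a (p i) * g i))
    ∧ ((a ∉ Subalgebra.toSubmodule (KH K) ⊔ Fset K) ↔ IsNoetherianRing (Cen K a))
    ∧ ((a ∉ Subalgebra.toSubmodule (KH K) ⊔ Fset K) ↔ IsNoetherianRing ((Cen K a)ᵐᵒᵖ))
    ∧ ((a ∉ Subalgebra.toSubmodule (KH K) ⊔ Fset K) ↔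
        ((Cen K a).FG ∧ IsNoetherianRing (Cen K a) ∧ IsNoetherianRing ((Cen K a)ᵐᵒᵖ))) := by
  have h_self := self_mem_Cen K haI
  have hleft : IsNoetherianRing (Cen K a) → a ∉ Subalgebra.toSubmodule (KH K) ⊔ Fset K := by
    intro hN h
    obtain ⟨e, he, hne, ho⟩ := exists_orthogonal_of_mem h
    exact not_isNoetherianRing_of_orthogonal e he hne ho hN
  have hright : IsNoetherianRing (Cen K a)ᵐᵒᵖ →
      a ∉ Subalgebra.toSubmodule (KH K) ⊔ Fset K := by
    intro hN h
    obtain ⟨e, he, hne, ho⟩ := exists_orthogonal_of_mem h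
    refine not_isNoetherianRing_of_orthogonal (fun n => MulOpposite.op (e n)) (fun n => ?_)
      (fun n => ?_) (fun m n hmn => ?_) hN
    · rw [← MulOpposite.op_mul, he]
    · simpa using hne n
    · rw [← MulOpposite.op_mul, ho n m hmn.symm, MulOpposite.op_zero]
  have hfg : Module.Finite K[X] (Module.AEval K (Cen K a) (⟨a, h_self⟩ : Cen K a)) →
      (Cen K a).FG ∧ IsNoetherianRing (Cen K a) ∧ IsNoetherianRing (Cen K a)ᵐᵒᵖ := by
    rw [Subalgebra.fg_iff_finiteType]
    exact noetherian_of_finite_aeval K _ fun b => Subtype.ext (mem_Cen_iff.1 b.2).2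
  have hfin := finite_Cen K haI
  rw [← finite_aeval_Cen_iff K haI]
  exact ⟨⟨hfin, fun h => hleft (hfg h).2.1⟩, ⟨fun h => (hfg (hfin h)).2.1, hleft⟩,
    ⟨fun h => (hfg (hfin h)).2.2, hright⟩, ⟨fun h => hfg (hfin h), fun h => hleft h.2.1⟩⟩

end
end
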